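/- Let f : V(a,b,r₁,r₂,n) → ℂᵐ be holomorphic and suppose that for some α ∈ ℝ the function |x|^{−α}|f(x,y)| is bounded near the origin. If [a′,b′] ⊂ (a,b) (or a′=a=−π and b′=b=π), then the restriction of f to V(a′,b′,r₁,r₂,n) is of order α: for every k ≥ 0 and every partial derivative g of f of order k, |x|^{k−α} g(x,y) is bounded near the origin on V(a′,b′,r₁,r₂,n). -/

import Mathlib

open Set Metric

/-- The sector-product domain `V(a,b,r₁,r₂,n) ⊆ ℂ* × ℂⁿ` (no restriction on the argument
when `a = −π` and `b = π`). -/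
def Sector (a b r₁ r₂ : ℝ) (n : ℕ) : Set (ℂ × (Fin n → ℂ)) :=
  {z | z.1 ≠ 0 ∧ ‖z.1‖ < r₁ ∧ ‖z.2‖ < r₂ ∧
    ((a = -Real.pi ∧ b = Real.pi) ∨ (a < z.1.arg ∧ z.1.arg < b))}

/-- `f : V → F` is of order `(α, p)` at the origin: for every `k ≤ p`, the `k`-th order
derivative `g` of `f` (taken within `V`) satisfies that `|x|^{k−α} ‖g(x,y)‖` is bounded
near the origin of `ℂ^{n+1}`. -/
def IsOrderOn {n : ℕ} {F : Type*} [NormedAddCommGroup F] [NormedSpace ℝ F]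
    (V : Set (ℂ × (Fin n → ℂ))) (f : ℂ × (Fin n → ℂ) → F) (α : ℝ) (p : ℕ) : Prop :=
  ∀ k ≤ p, ∃ C ε : ℝ, 0 < ε ∧ ∀ z ∈ V, ‖z‖ < ε →
    ‖z.1‖ ^ ((k : ℝ) - α) * ‖iteratedFDerivWithin ℝ k f V z‖ ≤ C


open Filter Topology Interval in
/-- Differentiation under the integral sign for a weighted average of translates of a bounded
holomorphic function. -/
theorem differentiableAt_intervalIntegral_smul_comp_add {E F : Type*} [NormedAddCommGroup E]
    [NormedSpace ℂ E] [FiniteDimensional ℂ E] [NormedAddCommGroup F] [NormedSpace ℂ F]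
    [FiniteDimensional ℂ F] {f : E → F} {z₀ : E} {R M s t : ℝ} (hR : 0 < R)
    (hf : DifferentiableOn ℂ f (ball z₀ (3 * R))) (hM : ∀ z ∈ ball z₀ (3 * R), ‖f z‖ ≤ M)
    {c : ℝ → ℂ} (hc : Continuous c) {γ : ℝ → E} (hγ : Continuous γ) (hγR : ∀ θ, ‖γ θ‖ < R) :
    DifferentiableAt ℂ (fun z ↦ ∫ θ in s..t, c θ • f (z + γ θ)) z₀ := by
  have hsub : ∀ x ∈ ball z₀ R, ∀ θ, ball (x + γ θ) R ⊆ ball z₀ (3 * R) := by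
    intro x hx θ
    refine ball_subset_ball' ?_
    have h1 : dist (x + γ θ) z₀ ≤ dist (x + γ θ) x + dist x z₀ := dist_triangle _ _ _
    have h2 : dist (x + γ θ) x = ‖γ θ‖ := by simp
    have h3 := hγR θ
    rw [mem_ball] at hx
    linarith
  have hmem : ∀ x ∈ ball z₀ R, ∀ θ, x + γ θ ∈ ball z₀ (3 * R) := fun x hx θ ↦
    hsub x hx θ (mem_ball_self hR)
  have hcont : ∀ x ∈ ball z₀ R, Continuous fun θ ↦ c θ • f (x + γ θ) := fun x hx ↦
    hc.smul (hf.continuousOn.comp_continuous (continuous_const.add hγ) (hmem x hx))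
  have hnorm : ∀ x ∈ ball z₀ R, ∀ θ, ‖fderiv ℂ f (x + γ θ)‖ ≤ (2 * M) / R := by
    intro x hx θ
    refine Complex.norm_fderiv_le_div_of_mapsTo_ball (hf.mono (hsub x hx θ)) ?_ hR
    intro y hy
    rw [mem_closedBall, dist_eq_norm]
    have h1 := norm_sub_le (f y) (f (x + γ θ))
    have h2 := hM y (hsub x hx θ hy)
    have h3 := hM _ (hmem x hx θ)
    linarith
  have hmeas : MeasureTheory.AEStronglyMeasurable (fun θ ↦ c θ • fderiv ℂ f (z₀ + γ θ))
      (MeasureTheory.volume.restrict (Ι s t)) := by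
    borelize E
    borelize (E →L[ℂ] F)
    have := FiniteDimensional.proper_rclike ℂ (E →L[ℂ] F)
    have := FiniteDimensional.complete ℂ F
    have h1 : Measurable fun θ ↦ fderiv ℂ f (z₀ + γ θ) :=
      (measurable_fderiv ℂ f).comp (continuous_const.add hγ).measurable
    exact (hc.stronglyMeasurable.smul h1.stronglyMeasurable).aestronglyMeasurable
  refine (intervalIntegral.hasFDerivAt_integral_of_dominated_of_fderiv_le
    (F' := fun x θ ↦ c θ • fderiv ℂ f (x + γ θ)) (bound := fun θ ↦ ‖c θ‖ * ((2 * M) / R))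
    (ball_mem_nhds z₀ hR) ?_ ?_ hmeas ?_ ?_ ?_).differentiableAt
  · filter_upwards [ball_mem_nhds z₀ hR] with x hx
    exact (hcont x hx).aestronglyMeasurable
  · exact (hcont z₀ (mem_ball_self hR)).intervalIntegrable _ _
  · refine Eventually.of_forall fun θ _ x hx ↦ ?_
    rw [norm_smul]
    gcongr
    exact hnorm x hx θ
  · exact (hc.norm.mul continuous_const).intervalIntegrable _ _
  · refine Eventually.of_forall fun θ _ x hx ↦ ?_
    have h1 : HasFDerivAt f (fderiv ℂ f (x + γ θ)) (x + γ θ) :=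
      (hf.differentiableAt (isOpen_ball.mem_nhds (hmem x hx θ))).hasFDerivAt
    exact ((hasFDerivAt_comp_add_right (γ θ)).2 h1).const_smul (c θ)

open Filter Topology in
/-- Directional derivatives of a holomorphic function of several variables are holomorphic. -/
theorem differentiableOn_fderiv_apply_of_isOpen {E F : Type*} [NormedAddCommGroup E]
    [NormedSpace ℂ E] [FiniteDimensional ℂ E] [NormedAddCommGroup F] [NormedSpace ℂ F]
    [FiniteDimensional ℂ F] {f : E → F} {U : Set E} (hU : IsOpen U)
    (hf : DifferentiableOn ℂ f U) (v : E) :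
    DifferentiableOn ℂ (fun z ↦ fderiv ℂ f z v) U := by
  intro z₀ hz₀
  refine DifferentiableAt.differentiableWithinAt ?_
  have := FiniteDimensional.complete ℂ F
  obtain ⟨R, hR, hball⟩ : ∃ R > 0, ball z₀ (3 * R) ⊆ U ∩ {z | ‖f z‖ ≤ ‖f z₀‖ + 1} := by
    have h1 : ∀ᶠ z in 𝓝 z₀, ‖f z‖ ≤ ‖f z₀‖ + 1 :=
      ((hf.differentiableAt (hU.mem_nhds hz₀)).continuousAt.norm.eventually_lt_const
        (lt_add_one _)).mono fun _ h ↦ h.le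
    obtain ⟨ε, hε, h⟩ := Metric.mem_nhds_iff.1 (inter_mem (hU.mem_nhds hz₀) h1)
    exact ⟨ε / 3, by positivity, by rwa [mul_div_cancel₀ _ (by norm_num)]⟩
  set r : ℝ := R / (2 * (‖v‖ + 1)) with hr
  have hr0 : 0 < r := by positivity
  have hrv : ∀ w : ℂ, ‖w‖ ≤ r → ‖w • v‖ < R := by
    intro w hw
    rw [norm_smul]
    calc ‖w‖ * ‖v‖ ≤ r * (‖v‖ + 1) := by gcongr; linarith
      _ = R / 2 := by rw [hr]; field_simp
      _ < R := by linarith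
  have hne : ∀ θ, circleMap 0 r θ ≠ 0 := fun θ ↦ circleMap_ne_center hr0.ne'
  have key := (differentiableAt_intervalIntegral_smul_comp_add (s := 0) (t := 2 * Real.pi) hR
    (hf.mono fun z hz ↦ (hball hz).1) (fun z hz ↦ (hball hz).2)
    (c := fun θ ↦ deriv (circleMap 0 r) θ * ((circleMap 0 r θ - 0) ^ 2)⁻¹)
    (γ := fun θ ↦ circleMap 0 r θ • v)
    (by
      simp only [deriv_circleMap, sub_zero]
      exact ((continuous_circleMap 0 r).mul continuous_const).mul
        (((continuous_circleMap 0 r).pow 2).inv₀ fun θ ↦ pow_ne_zero 2 (hne θ)))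
    ((continuous_circleMap 0 r).smul continuous_const)
    (fun θ ↦ hrv _ (by simp [abs_of_pos hr0]))).const_smul ((2 * Real.pi * Complex.I : ℂ)⁻¹)
  refine key.congr_of_eventuallyEq ?_
  filter_upwards [ball_mem_nhds z₀ hR] with z hz
  have hmem : ∀ w : ℂ, ‖w‖ ≤ r → z + w • v ∈ U := by
    intro w hw
    refine (hball ?_).1
    rw [mem_ball] at hz ⊢
    have h1 : dist (z + w • v) z₀ ≤ dist (z + w • v) z + dist z z₀ := dist_triangle _ _ _
    have h2 : dist (z + w • v) z = ‖w • v‖ := by simp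
    have h3 := hrv w hw
    linarith
  have hline : Continuous fun w : ℂ ↦ z + w • v := by fun_prop
  have hderiv : HasDerivAt (fun w : ℂ ↦ f (z + w • v)) (fderiv ℂ f z v) 0 := by
    have h1 : HasFDerivAt f (fderiv ℂ f z) (z + (0 : ℂ) • v) := by
      have h0 : z ∈ U := by simpa using hmem 0 (by simpa using hr0.le)
      simpa using (hf.differentiableAt (hU.mem_nhds h0)).hasFDerivAt
    have h2 : HasDerivAt (fun w : ℂ ↦ z + w • v) v 0 := by
      simpa using ((hasDerivAt_id (0 : ℂ)).smul_const v).const_add z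
    exact h1.comp_hasDerivAt 0 h2
  have hcd := Complex.cderiv_eq_deriv (f := fun w : ℂ ↦ f (z + w • v)) (z := 0) (r := r)
    (hU.preimage hline) (hf.comp (by fun_prop) fun w hw ↦ hw) hr0
    (fun w hw ↦ hmem w (by simpa using hw))
  rw [← hderiv.deriv, ← hcd, Complex.cderiv, circleIntegral]
  simp only [smul_smul, Pi.smul_apply]

/-- A holomorphic function of several variables is smooth. -/
theorem DifferentiableOn.contDiffOn_of_finiteDimensional {E F : Type*} [NormedAddCommGroup E]
    [NormedSpace ℂ E] [FiniteDimensional ℂ E] [NormedAddCommGroup F] [NormedSpace ℂ F]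
    [FiniteDimensional ℂ F] {f : E → F} {U : Set E} (hU : IsOpen U)
    (hf : DifferentiableOn ℂ f U) (k : ℕ) : ContDiffOn ℂ k f U := by
  induction k generalizing f with
  | zero => exact contDiffOn_zero.2 hf.continuousOn
  | succ k ih =>
    rw [Nat.cast_succ, contDiffOn_succ_iff_fderiv_of_isOpen hU]
    exact ⟨hf, by simp, contDiffOn_clm_apply.2 fun v ↦
      ih (differentiableOn_fderiv_apply_of_isOpen hU hf v)⟩

/-- Cauchy estimates for the iterated derivatives of a bounded holomorphic function. -/
theorem exists_norm_iteratedFDeriv_le_mul_div_pow.{u} {E : Type u} [NormedAddCommGroup E]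
    [NormedSpace ℂ E] [FiniteDimensional ℂ E] (k : ℕ) : ∃ K : ℝ,
    ∀ {F : Type u} [NormedAddCommGroup F] [NormedSpace ℂ F] [FiniteDimensional ℂ F]
      {f : E → F} {z : E} {R M : ℝ}, 0 < R → DifferentiableOn ℂ f (ball z R) →
      (∀ w ∈ ball z R, ‖f w‖ ≤ M) → ‖iteratedFDeriv ℂ k f z‖ ≤ K * M / R ^ k := by
  induction k with
  | zero =>
    refine ⟨1, fun {F} _ _ _ f z R M hR _ hM ↦ ?_⟩
    simpa using hM z (mem_ball_self hR)
  | succ k ih =>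
    obtain ⟨K, ih⟩ := ih
    refine ⟨K * 4 * 2 ^ k, fun {F} _ _ _ f z R M hR hf hM ↦ ?_⟩
    have hdf : DifferentiableOn ℂ (fderiv ℂ f) (ball z R) :=
      ((hf.contDiffOn_of_finiteDimensional isOpen_ball 2).fderiv_of_isOpen (m := 1) isOpen_ball
        (by norm_num)).differentiableOn (by norm_num)
    have hbd : ∀ w ∈ ball z (R / 2), ‖fderiv ℂ f w‖ ≤ (2 * M) / (R / 2) := by
      intro w hw
      have hsub : ball w (R / 2) ⊆ ball z R := ball_subset_ball' (by
        rw [mem_ball] at hw; linarith)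
      refine Complex.norm_fderiv_le_div_of_mapsTo_ball (hf.mono hsub) ?_ (by positivity)
      intro y hy
      rw [mem_closedBall, dist_eq_norm]
      have h1 := norm_sub_le (f y) (f w)
      have h2 := hM y (hsub hy)
      have h3 := hM w (hsub (mem_ball_self (by positivity)))
      linarith
    rw [← norm_iteratedFDeriv_fderiv]
    refine (ih (half_pos hR) (hdf.mono (ball_subset_ball (by linarith))) hbd).trans_eq ?_
    rw [div_pow]
    field_simp
    ring

open Filter Topology in
theorem isOpen_sector {a b r₁ r₂ : ℝ} (n : ℕ) (hb : b ≤ Real.pi) :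
    IsOpen (Sector a b r₁ r₂ n) := by
  rw [isOpen_iff_eventually]
  rintro z ⟨h0, h1, h2, h3⟩
  have hfst : ContinuousAt (fun w : ℂ × (Fin n → ℂ) ↦ w.1) z := continuousAt_fst
  have hsnd : ContinuousAt (fun w : ℂ × (Fin n → ℂ) ↦ w.2) z := continuousAt_snd
  refine (hfst.eventually_ne h0).and ((hfst.norm.eventually_lt_const h1).and
    ((hsnd.norm.eventually_lt_const h2).and ?_))
  rcases h3 with h3 | ⟨h3, h4⟩
  · exact Eventually.of_forall fun _ ↦ Or.inl h3
  · have hslit : z.1 ∈ Complex.slitPlane :=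
      Complex.mem_slitPlane_iff_arg.2 ⟨(h4.trans_le hb).ne, h0⟩
    have harg : ContinuousAt (fun w : ℂ × (Fin n → ℂ) ↦ w.1.arg) z :=
      ContinuousAt.comp (g := Complex.arg) (Complex.continuousAt_arg hslit) hfst
    exact ((harg.eventually_const_lt h3).and (harg.eventually_lt_const h4)).mono
      fun _ h ↦ Or.inr h

open Filter Topology in
/-- A relative perturbation of size less than `c` changes the argument by little, so that it stays
in a strictly larger interval. -/
theorem exists_forall_arg_mem_Ioo {a b a' b' : ℝ} (hab : -Real.pi ≤ a) (hb : b ≤ Real.pi)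
    (ha' : a < a') (hb' : b' < b) :
    ∃ c : ℝ, 0 < c ∧ c ≤ 1 / 2 ∧ ∀ x y : ℂ, a' < x.arg → x.arg < b' →
      ‖y - x‖ < c * ‖x‖ → a < y.arg ∧ y.arg < b := by
  have harg : Tendsto Complex.arg (𝓝 1) (𝓝 0) := by
    simpa using (Complex.continuousAt_arg Complex.one_mem_slitPlane).tendsto
  have h1 : ∀ᶠ w : ℂ in 𝓝 1, a - a' < w.arg ∧ w.arg < b - b' :=
    (harg.eventually_const_lt (sub_neg.2 ha')).and (harg.eventually_lt_const (sub_pos.2 hb'))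
  obtain ⟨ε, hε, h⟩ := Metric.eventually_nhds_iff.1 h1
  refine ⟨min ε (1 / 2), by positivity, min_le_right _ _, fun x y hx1 hx2 hy ↦ ?_⟩
  have hx : x ≠ 0 := by
    rintro rfl
    simp at hy
    linarith [norm_nonneg y]
  have hx' : 0 < ‖x‖ := norm_pos_iff.2 hx
  have hd : dist (y / x) 1 < min ε (1 / 2) := by
    rw [dist_eq_norm, div_sub_one hx, norm_div, div_lt_iff₀ hx']
    exact hy
  obtain ⟨h2, h3⟩ := h (hd.trans_le (min_le_left _ _))
  have hw : y / x ≠ 0 := by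
    intro h0
    rw [h0, dist_zero_left, norm_one] at hd
    linarith [min_le_right ε (1 / 2)]
  have hmul : (x * (y / x)).arg = x.arg + (y / x).arg :=
    Complex.arg_mul hx hw ⟨by linarith, by linarith⟩
  rw [mul_div_cancel₀ _ hx] at hmul
  constructor <;> linarith

/-- Around each point `z` of the smaller sector, a ball of radius proportional to `‖z.1‖` lies in
the larger one. -/
theorem exists_forall_mem_sector {a b a' b' r₁ r₂ : ℝ} (n : ℕ) (hab : -Real.pi ≤ a)
    (hb : b ≤ Real.pi)
    (hsub : (a < a' ∧ a' < b' ∧ b' < b) ∨ (a' = a ∧ a = -Real.pi ∧ b' = b ∧ b = Real.pi)) :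
    ∃ c : ℝ, 0 < c ∧ c ≤ 1 / 2 ∧ ∀ z ∈ Sector a' b' r₁ r₂ n, ∀ w : ℂ × (Fin n → ℂ),
      ‖w - z‖ < c * ‖z.1‖ → ‖w.1‖ < r₁ → ‖w.2‖ < r₂ → w ∈ Sector a b r₁ r₂ n := by
  have hne : ∀ {c : ℝ} {z w : ℂ × (Fin n → ℂ)}, c ≤ 1 / 2 → ‖w - z‖ < c * ‖z.1‖ → w.1 ≠ 0 := by
    intro c z w hc hw h0
    have h1 : ‖z.1‖ ≤ ‖w - z‖ := by simpa [h0] using norm_fst_le (w - z)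
    nlinarith [norm_nonneg z.1]
  rcases hsub with ⟨h1, h2, h3⟩ | ⟨-, h2, -, h4⟩
  · obtain ⟨c, hc, hc2, h⟩ := exists_forall_arg_mem_Ioo hab hb h1 h3
    refine ⟨c, hc, hc2, fun z hz w hw hw1 hw2 ↦ ⟨hne hc2 hw, hw1, hw2, Or.inr ?_⟩⟩
    obtain ⟨-, -, -, hz⟩ := hz
    rcases hz with hz | hz
    · linarith
    · exact h z.1 w.1 hz.1 hz.2 ((norm_fst_le (w - z)).trans_lt hw)
  · exact ⟨1 / 2, by norm_num, le_rfl, fun z _ w hw hw1 hw2 ↦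
      ⟨hne le_rfl hw, hw1, hw2, Or.inl ⟨h2, h4⟩⟩⟩

theorem Real.rpow_le_two_rpow_abs_mul_rpow {s t : ℝ} (hs : 0 < s) (h1 : s / 2 ≤ t)
    (h2 : t ≤ 2 * s) (α : ℝ) : t ^ α ≤ 2 ^ |α| * s ^ α := by
  have ht : 0 < t := by linarith
  rcases le_total 0 α with hα | hα
  · rw [abs_of_nonneg hα, ← Real.mul_rpow zero_le_two hs.le]
    exact Real.rpow_le_rpow ht.le h2 hα
  · rw [abs_of_nonpos hα, Real.rpow_neg zero_le_two, ← Real.inv_rpow zero_le_two,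
      ← Real.mul_rpow (by norm_num) hs.le]
    exact Real.rpow_le_rpow_of_nonpos (by positivity) (by linarith) hα

/-- if `f` is holomorphic on `V(a,b,r₁,r₂,n)` and `|x|^{−α}|f(x,y)|` is bounded
near the origin, then on any strictly smaller sector `V(a′,b′,r₁,r₂,n)` (with
`[a′,b′] ⊂ (a,b)`, or `a′=a=−π` and `b′=b=π`) the restriction of `f` is of order `α`, i.e. of
order `(α, p)` for every `p`. -/
theorem stmt10 (n m : ℕ) (a b a' b' r₁ r₂ α : ℝ)
    (hab : -Real.pi ≤ a) (hab' : a < b) (hb : b ≤ Real.pi) (hr₁ : 0 < r₁) (hr₂ : 0 < r₂)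
    (hsub : (a < a' ∧ a' < b' ∧ b' < b) ∨ (a' = a ∧ a = -Real.pi ∧ b' = b ∧ b = Real.pi))
    (f : ℂ × (Fin n → ℂ) → EuclideanSpace ℂ (Fin m))
    (hf : DifferentiableOn ℂ f (Sector a b r₁ r₂ n))
    (hbound : ∃ C ε : ℝ, 0 < ε ∧ ∀ z ∈ Sector a b r₁ r₂ n, ‖z‖ < ε →
      ‖f z‖ ≤ C * ‖z.1‖ ^ α) :
    ∀ p : ℕ, IsOrderOn (Sector a' b' r₁ r₂ n) f α p := by
  intro p k _
  obtain ⟨C, ε, hε, hC⟩ := hbound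
  obtain ⟨c, hc, hc2, hsector⟩ := exists_forall_mem_sector (r₁ := r₁) (r₂ := r₂) n hab hb hsub
  obtain ⟨K, hcauchy⟩ := exists_norm_iteratedFDeriv_le_mul_div_pow (E := ℂ × (Fin n → ℂ)) k
  have hb' : b' ≤ Real.pi := by rcases hsub with h | h <;> linarith [h.2.2]
  refine ⟨K * (|C| * 2 ^ |α|) / c ^ k, min ε (min r₁ r₂) / 2, by positivity, fun z hz hzε ↦ ?_⟩
  have hx : 0 < ‖z.1‖ := norm_pos_iff.2 hz.1
  have hR : 0 < c * ‖z.1‖ := by positivity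
  have hclose : ∀ w ∈ ball z (c * ‖z.1‖), ‖w - z‖ < c * ‖z.1‖ := fun w hw ↦ by
    rwa [← dist_eq_norm]
  have hnorm : ∀ w ∈ ball z (c * ‖z.1‖), ‖w‖ < min ε (min r₁ r₂) := by
    intro w hw
    have h1 := hclose w hw
    have h2 := norm_le_norm_add_norm_sub' w z
    have h3 := norm_fst_le z
    nlinarith
  have hball : ball z (c * ‖z.1‖) ⊆ Sector a b r₁ r₂ n := by
    intro w hw
    have h1 := hnorm w hw
    exact hsector z hz w (hclose w hw)
      ((norm_fst_le w).trans_lt (h1.trans_le ((min_le_right _ _).trans (min_le_left _ _))))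
      ((norm_snd_le w).trans_lt (h1.trans_le ((min_le_right _ _).trans (min_le_right _ _))))
  have hM : ∀ w ∈ ball z (c * ‖z.1‖), ‖f w‖ ≤ |C| * (2 ^ |α| * ‖z.1‖ ^ α) := by
    intro w hw
    have h1 := (norm_fst_le (w - z)).trans_lt (hclose w hw)
    rw [Prod.fst_sub] at h1
    have h2 := norm_le_norm_add_norm_sub' w.1 z.1
    have h3 := norm_le_norm_add_norm_sub w.1 z.1
    calc ‖f w‖ ≤ C * ‖w.1‖ ^ α := hC w (hball hw) ((hnorm w hw).trans_le (min_le_left _ _))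
      _ ≤ |C| * ‖w.1‖ ^ α := by gcongr; exact le_abs_self C
      _ ≤ |C| * (2 ^ |α| * ‖z.1‖ ^ α) := by
        gcongr
        exact Real.rpow_le_two_rpow_abs_mul_rpow hx (by nlinarith) (by nlinarith) α
  have hdiff := hf.mono hball
  have hsmooth : ContDiffAt ℂ k f z :=
    (hdiff.contDiffOn_of_finiteDimensional isOpen_ball k).contDiffAt (ball_mem_nhds z hR)
  rw [iteratedFDerivWithin_of_isOpen k (isOpen_sector n hb') hz,
    ← hsmooth.restrictScalars_iteratedFDeriv, Function.comp_apply,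
    ContinuousMultilinearMap.norm_restrictScalars]
  calc ‖z.1‖ ^ ((k : ℝ) - α) * ‖iteratedFDeriv ℂ k f z‖
      ≤ ‖z.1‖ ^ ((k : ℝ) - α) * (K * (|C| * (2 ^ |α| * ‖z.1‖ ^ α)) / (c * ‖z.1‖) ^ k) := by
        gcongr
        exact hcauchy hR hdiff hM
    _ = K * (|C| * 2 ^ |α|) / c ^ k := by
        rw [Real.rpow_sub hx, Real.rpow_natCast, mul_pow]
        have := (Real.rpow_pos_of_pos hx α).ne'
        field_simp
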